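/- Let x be a point of the unit square [0,1] × [0,1] in the Euclidean plane ℝ² and let ρ be a real number with 0 < ρ ≤ 1. Then the two-dimensional Lebesgue measure of the intersection of the closed Euclidean ball of radius ρ centered at x with the unit square [0,1] × [0,1] is at least π·ρ²/4. -/

import Mathlib

open MeasureTheory Real

/-- The interval exchange of `[0, 1]` that moves `[c, 1]` to `[0, 1 - c]` by translation and
`[0, c)` to `(1 - c, 1]` by reflection. -/
noncomputable def unitIntervalFold (c y : ℝ) : ℝ := if c ≤ y then y - c else 1 - y

lemma measurable_unitIntervalFold (c : ℝ) : Measurable (unitIntervalFold c) :=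
  Measurable.ite measurableSet_Ici (by fun_prop) (by fun_prop)

lemma sq_sub_le_sq_unitIntervalFold {c y : ℝ} (hc : c ∈ Set.Icc (0 : ℝ) 1) :
    (y - c) ^ 2 ≤ unitIntervalFold c y ^ 2 := by
  obtain ⟨-, hc1⟩ := hc
  unfold unitIntervalFold
  split_ifs with h
  · exact le_rfl
  · nlinarith

lemma measurePreserving_unitIntervalFold {c : ℝ} (hc : c ∈ Set.Icc (0 : ℝ) 1) :
    MeasurePreserving (unitIntervalFold c) (volume.restrict (Set.Icc 0 1))
      (volume.restrict (Set.Icc 0 1)) := by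
  obtain ⟨hc0, hc1⟩ := hc
  refine ⟨measurable_unitIntervalFold c, ?_⟩
  ext S hS
  have hpre := measurable_unitIntervalFold c hS
  rw [Measure.map_apply (measurable_unitIntervalFold c) hS, Measure.restrict_apply hpre,
    Measure.restrict_apply hS,
    ← measure_inter_add_sdiff (unitIntervalFold c ⁻¹' S ∩ Set.Icc 0 1)
      (measurableSet_Ici (a := c)),
    ← measure_inter_add_sdiff (S ∩ Set.Icc 0 1) (measurableSet_Iic (a := 1 - c))]
  have hS' : MeasurableSet (S ∩ Set.Icc 0 1) := hS.inter measurableSet_Icc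
  congr 1
  · rw [← (measurePreserving_sub_right volume c).measure_preimage
      (hS'.inter measurableSet_Iic).nullMeasurableSet]
    congr 1
    ext y
    simp only [unitIntervalFold, Set.mem_inter_iff, Set.mem_preimage, Set.mem_Icc, Set.mem_Ici,
      Set.mem_Iic]
    constructor
    · rintro ⟨⟨h, h0, h1⟩, h2⟩
      rw [if_pos h2] at h
      exact ⟨⟨h, by linarith, by linarith⟩, by linarith⟩
    · rintro ⟨⟨h, h0, h1⟩, h2⟩
      have h3 : c ≤ y := by linarith
      rw [if_pos h3]
      exact ⟨⟨h, by linarith, by linarith⟩, h3⟩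
  · rw [← (Measure.measurePreserving_sub_left volume (1 : ℝ)).measure_preimage
      (hS'.diff measurableSet_Iic).nullMeasurableSet]
    congr 1
    ext y
    simp only [unitIntervalFold, Set.mem_inter_iff, Set.mem_preimage, Set.mem_Icc, Set.mem_Ici,
      Set.mem_Iic, Set.mem_sdiff, not_le]
    constructor
    · rintro ⟨⟨h, h0, h1⟩, h2⟩
      rw [if_neg h2.not_ge] at h
      exact ⟨⟨h, by linarith, by linarith⟩, by linarith⟩
    · rintro ⟨⟨h, h0, h1⟩, h2⟩
      have h3 : y < c := by linarith
      rw [if_neg h3.not_ge]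
      exact ⟨⟨h, by linarith, by linarith⟩, h3⟩

lemma volume_closedBall_le_four_mul_volume_quadrant (ρ : ℝ) :
    volume (Metric.closedBall (0 : EuclideanSpace ℝ (Fin 2)) ρ) ≤
      4 * volume (Metric.closedBall (0 : EuclideanSpace ℝ (Fin 2)) ρ ∩ {p | ∀ i, 0 ≤ p i}) := by
  set Q := Metric.closedBall (0 : EuclideanSpace ℝ (Fin 2)) ρ ∩ {p | ∀ i, 0 ≤ p i}
  let s : Bool → (ℝ ≃ₗᵢ[ℝ] ℝ) := fun b => if b then .refl ℝ ℝ else .neg ℝ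
  let T : (Fin 2 → Bool) → (EuclideanSpace ℝ (Fin 2) ≃ₗᵢ[ℝ] EuclideanSpace ℝ (Fin 2)) :=
    fun σ => LinearIsometryEquiv.piLpCongrRight 2 fun i => s (σ i)
  have hsub : Metric.closedBall (0 : EuclideanSpace ℝ (Fin 2)) ρ ⊆ ⋃ σ, T σ ⁻¹' Q := by
    intro p hp
    refine Set.mem_iUnion.2 ⟨fun i => decide (0 ≤ p i), ?_, fun i => ?_⟩
    · simpa using hp
    · by_cases h : 0 ≤ p i
      · simp [T, s, h]
      · simpa [T, s, h] using (not_le.1 h).le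
  calc volume (Metric.closedBall (0 : EuclideanSpace ℝ (Fin 2)) ρ)
      ≤ volume (⋃ σ, T σ ⁻¹' Q) := measure_mono hsub
    _ ≤ ∑ σ, volume (T σ ⁻¹' Q) := measure_iUnion_fintype_le _ _
    _ = ∑ _σ : Fin 2 → Bool, volume Q := Finset.sum_congr rfl fun σ _ =>
        (T σ).measurePreserving.measure_preimage_emb
          (T σ).toHomeomorph.measurableEmbedding Q
    _ = 4 * volume Q := by simp

/-- Each point of the unit square 'consumes' at least a quarter disk: for any
`x` in the unit square and `0 < ρ ≤ 1`, the area of the intersection of the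
closed Euclidean ball of radius `ρ` centred at `x` with the unit square is at
least `π·ρ²/4`. -/
theorem quarter_disk_in_unit_square
    (x : EuclideanSpace ℝ (Fin 2)) (hx : ∀ i, x i ∈ Set.Icc (0:ℝ) 1)
    (ρ : ℝ) (hρ : 0 < ρ) (hρ1 : ρ ≤ 1) :
    ENNReal.ofReal (π * ρ ^ 2 / 4) ≤
      volume (Metric.closedBall x ρ ∩
        {p : EuclideanSpace ℝ (Fin 2) | ∀ i, p i ∈ Set.Icc (0:ℝ) 1}) := by
  have hball : ∀ z p : EuclideanSpace ℝ (Fin 2), p ∈ Metric.closedBall z ρ ↔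
      (p 0 - z 0) ^ 2 + (p 1 - z 1) ^ 2 ≤ ρ ^ 2 := by
    intro z p
    rw [Metric.mem_closedBall, EuclideanSpace.dist_eq, Real.sqrt_le_left hρ.le]
    simp [Real.dist_eq]
  let K : Set (Fin 2 → ℝ) := Set.univ.pi fun _ => Set.Icc 0 1
  let D : Set (Fin 2 → ℝ) := {v | v 0 ^ 2 + v 1 ^ 2 ≤ ρ ^ 2}
  have hK : MeasurableSet K := .univ_pi fun _ => measurableSet_Icc
  have hD : MeasurableSet D := measurableSet_le (by fun_prop) (by fun_prop)
  let Ψ : (Fin 2 → ℝ) → (Fin 2 → ℝ) := fun v i => unitIntervalFold (x i) (v i)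
  have hΨ : MeasurePreserving Ψ (volume.restrict K) (volume.restrict K) := by
    have h := measurePreserving_pi (fun _ : Fin 2 => (volume : Measure ℝ).restrict (Set.Icc 0 1))
      (fun _ => volume.restrict (Set.Icc 0 1))
      fun i => measurePreserving_unitIntervalFold (hx i)
    rwa [← Measure.restrict_pi_pi] at h
  have hofLp := PiLp.volume_preserving_ofLp (Fin 2)
  have hquad : ENNReal.ofReal (π * ρ ^ 2 / 4) ≤
      volume (Metric.closedBall (0 : EuclideanSpace ℝ (Fin 2)) ρ ∩ {p | ∀ i, 0 ≤ p i}) := by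
    have h := volume_closedBall_le_four_mul_volume_quadrant ρ
    rw [EuclideanSpace.volume_closedBall_fin_two] at h
    rw [ENNReal.ofReal_div_of_pos (by norm_num)]
    refine ENNReal.div_le_of_le_mul' ?_
    rw [mul_comm π, ENNReal.ofReal_mul (by positivity), ENNReal.ofReal_pow hρ.le]
    rwa [ENNReal.ofReal_ofNat]
  calc ENNReal.ofReal (π * ρ ^ 2 / 4)
      ≤ _ := hquad
    _ ≤ volume (WithLp.ofLp (p := 2) ⁻¹' (D ∩ K)) := by
        refine measure_mono fun p ⟨hp, h0⟩ => ?_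
        have hp' := (hball 0 p).1 hp
        simp only [PiLp.zero_apply, sub_zero] at hp'
        refine ⟨hp', fun i _ => ⟨h0 i, ?_⟩⟩
        fin_cases i
        · change p 0 ≤ 1
          nlinarith [sq_nonneg (p 1)]
        · change p 1 ≤ 1
          nlinarith [sq_nonneg (p 0)]
    _ = volume (D ∩ K) := hofLp.measure_preimage (hD.inter hK).nullMeasurableSet
    _ = volume (Ψ ⁻¹' D ∩ K) := by
        have h := hΨ.measure_preimage hD.nullMeasurableSet
        rw [Measure.restrict_apply' hK, Measure.restrict_apply' hK] at h
        exact h.symm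
    _ = volume (WithLp.ofLp (p := 2) ⁻¹' (Ψ ⁻¹' D ∩ K)) := by
        have hΨm : Measurable Ψ := hΨ.measurable
        exact (hofLp.measure_preimage ((hΨm hD).inter hK).nullMeasurableSet).symm
    _ ≤ _ := by
        refine measure_mono fun p ⟨hp, hpK⟩ => ⟨(hball x p).2 ?_, fun i => hpK i trivial⟩
        exact (add_le_add (sq_sub_le_sq_unitIntervalFold (hx 0))
          (sq_sub_le_sq_unitIntervalFold (hx 1))).trans hp
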